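/- Let C(n,d) denote the maximum, over all choices of d vectors v_1,…,v_d ∈ ℝ^n, of the number of sign vectors ε ∈ {−1,1}^n for which some x in the linear span of {v_1,…,v_d} satisfies ε_i x_i > 0 for all i, with the convention C(n,0) = 0. Then for every integer d with 0 ≤ d ≤ n, C(n,d) = 2^n − C(n, n−d). -/

import Mathlib

open Finset

/-- The number of open orthants of `ℝ^n` (equivalently, full sign patterns)
properly intersected by the linear span of the vectors `v 0, …, v (d-1)`. -/
noncomputable def orthantCount (n d : ℕ) (v : Fin d → (Fin n → ℝ)) : ℕ :=
  {ε : Fin n → ℝ | (∀ i, ε i = 1 ∨ ε i = -1) ∧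
      ∃ x ∈ Submodule.span ℝ (Set.range v), ∀ i, 0 < ε i * x i}.ncard

/-- `C n d`: the maximum number of open orthants of `ℝ^n` intersected by the
linear span of `d` vectors, with the convention `C n 0 = 0`. -/
noncomputable def maxOrthantCount (n d : ℕ) : ℕ :=
  if d = 0 then 0
  else sSup {c : ℕ | ∃ v : Fin d → (Fin n → ℝ), c = orthantCount n d v}

/-- If a subspace of `ℝ^ι` realizes every sign pattern on the coordinates in `J`,
then its dimension is at least the cardinality of `J`. -/
theorem card_le_finrank_of_signs {ι : Type*} [Finite ι] (V : Submodule ℝ (ι → ℝ))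
    (J : Finset ι)
    (h : ∀ P : ι → Prop, ∃ x ∈ V, ∀ i ∈ J, (P i → 0 < x i) ∧ (¬ P i → x i < 0)) :
    #J ≤ Module.finrank ℝ V := by
  have hli : LinearIndependent ℝ
      (fun i : J => (LinearMap.proj (i : ι) : (ι → ℝ) →ₗ[ℝ] ℝ) ∘ₗ V.subtype) := by
    rw [Fintype.linearIndependent_iff]
    intro g hg
    obtain ⟨x, hxV, hx⟩ := h (fun i => ∃ hi : i ∈ J, 0 < g ⟨i, hi⟩)
    have hsum : ∑ i : J, g i * x i = 0 := by
      simpa using LinearMap.congr_fun hg ⟨x, hxV⟩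
    have hsign (i : J) : x i ≠ 0 ∧ 0 ≤ g i * x i := by
      obtain ⟨hpos, hneg⟩ := hx i i.2
      by_cases hgi : 0 < g i
      · have := hpos ⟨i.2, hgi⟩
        exact ⟨this.ne', by positivity⟩
      · have := hneg (fun ⟨_, h'⟩ => hgi h')
        exact ⟨this.ne, mul_nonneg_of_nonpos_of_nonpos (not_lt.mp hgi) this.le⟩
    rw [Finset.sum_eq_zero_iff_of_nonneg (fun i _ => (hsign i).2)] at hsum
    intro i
    exact (mul_eq_zero.mp (hsum i (mem_univ i))).resolve_right (hsign i).1
  have := hli.fintype_card_le_finrank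
  rwa [Fintype.card_coe, Subspace.dual_finrank_eq] at this

open Classical in
/-- The sign patterns of the vectors of `V` with positive first coordinate, each recorded as
the set of the remaining coordinates that are positive. -/
noncomputable def positivePatterns {m : ℕ} (V : Submodule ℝ (Fin (m + 1) → ℝ)) :
    Finset (Finset (Fin m)) :=
  {T | ∃ x ∈ V, 0 < x 0 ∧ ∀ i : Fin m, (i ∈ T → 0 < x i.succ) ∧ (i ∉ T → x i.succ < 0)}

theorem mem_positivePatterns {m : ℕ} {V : Submodule ℝ (Fin (m + 1) → ℝ)} {T : Finset (Fin m)} :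
    T ∈ positivePatterns V ↔ ∃ x ∈ V, 0 < x 0 ∧
      ∀ i : Fin m, (i ∈ T → 0 < x i.succ) ∧ (i ∉ T → x i.succ < 0) := by
  simp [positivePatterns]

/-- A set shattered by `positivePatterns V`, together with the first coordinate, is a set of
coordinates on which `V` realizes every sign pattern. -/
theorem card_lt_finrank_of_shatters {m : ℕ} (V : Submodule ℝ (Fin (m + 1) → ℝ))
    (S : Finset (Fin m)) (hS : (positivePatterns V).Shatters S) :
    #S < Module.finrank ℝ V := by
  classical
  have key := card_le_finrank_of_signs V (insert 0 (S.map (Fin.succEmb m))) ?_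
  · rwa [card_insert_of_notMem (by simp), card_map] at key
  intro P
  by_cases h0 : P 0
  · obtain ⟨T, hT, hST⟩ := hS (filter_subset (fun i => P i.succ) S)
    obtain ⟨x, hxV, hx0, hx⟩ := mem_positivePatterns.mp hT
    refine ⟨x, hxV, ?_⟩
    simp only [mem_insert, mem_map, forall_eq_or_imp, forall_exists_index, and_imp]
    refine ⟨⟨fun _ => hx0, fun h => absurd h0 h⟩, ?_⟩
    rintro _ i hi rfl
    have := Finset.ext_iff.mp hST i
    simp only [mem_inter, mem_filter, hi, true_and] at this
    simpa [this] using hx i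
  · obtain ⟨T, hT, hST⟩ := hS (filter_subset (fun i => ¬ P i.succ) S)
    obtain ⟨x, hxV, hx0, hx⟩ := mem_positivePatterns.mp hT
    refine ⟨-x, V.neg_mem hxV, ?_⟩
    simp only [mem_insert, mem_map, forall_eq_or_imp, forall_exists_index, and_imp]
    refine ⟨⟨fun h => absurd h h0, fun _ => by simpa using hx0⟩, ?_⟩
    rintro _ i hi rfl
    have := Finset.ext_iff.mp hST i
    simp only [mem_inter, mem_filter, hi, true_and] at this
    simpa [this, and_comm] using hx i

theorem card_positivePatterns_le {m : ℕ} (V : Submodule ℝ (Fin (m + 1) → ℝ)) :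
    #(positivePatterns V) ≤ ∑ i ∈ range (Module.finrank ℝ V), m.choose i := by
  classical
  calc #(positivePatterns V) ≤ #(positivePatterns V).shatterer := card_le_card_shatterer _
    _ ≤ #((range (Module.finrank ℝ V)).biUnion
          fun i => powersetCard i (univ : Finset (Fin m))) := by
        refine card_le_card fun S hS => ?_
        simpa using card_lt_finrank_of_shatters V S (mem_shatterer.mp hS)
    _ ≤ ∑ i ∈ range (Module.finrank ℝ V), #(powersetCard i (univ : Finset (Fin m))) :=
        card_biUnion_le
    _ = _ := by simp

theorem finite_signs (n : ℕ) (p : (Fin n → ℝ) → Prop) :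
    {ε : Fin n → ℝ | (∀ i, ε i = 1 ∨ ε i = -1) ∧ p ε}.Finite :=
  (Set.Finite.pi' (t := fun _ : Fin n => ({1, -1} : Set ℝ)) fun _ => Set.toFinite _).subset
    fun ε hε i => by simpa using hε.1 i

theorem orthantCount_le (m d : ℕ) (v : Fin d → (Fin (m + 1) → ℝ)) :
    orthantCount (m + 1) d v ≤ 2 * ∑ i ∈ range d, m.choose i := by
  classical
  set V := Submodule.span ℝ (Set.range v)
  have hrank : Module.finrank ℝ V ≤ d := by
    simpa [Set.finrank] using finrank_range_le_card (R := ℝ) v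
  have hle : orthantCount (m + 1) d v ≤
      (((univ : Finset Prop) ×ˢ positivePatterns V : Finset (Prop × Finset (Fin m))) :
        Set (Prop × Finset (Fin m))).ncard := by
    refine Set.ncard_le_ncard_of_injOn
      (fun ε => (ε 0 = 1, ({i | ε (Fin.succ i) = ε 0} : Finset (Fin m)))) ?_ ?_
      (Finset.finite_toSet _)
    · rintro ε ⟨hε, x, hxV, hx⟩
      simp only [coe_product, Set.mem_prod, mem_coe, mem_univ, true_and]
      refine mem_positivePatterns.mpr ⟨ε 0 • x, V.smul_mem _ hxV, hx 0, fun i => ?_⟩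
      have hi := hx i.succ
      simp only [mem_filter, mem_univ, true_and, Pi.smul_apply, smul_eq_mul]
      refine ⟨fun h => h ▸ hi, fun h => ?_⟩
      have : ε i.succ = -ε 0 := by
        rcases hε i.succ with h1 | h1 <;> rcases hε 0 with h2 | h2 <;> simp_all
      rw [this] at hi
      linarith
    · rintro ε ⟨hε, -⟩ δ ⟨hδ, -⟩ h
      simp only [Prod.mk.injEq, eq_iff_iff, Finset.ext_iff, mem_filter, mem_univ, true_and] at h
      have h0 : ε 0 = δ 0 := by
        rcases hε 0 with h1 | h1 <;> rcases hδ 0 with h2 | h2 <;> simp_all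
      funext i
      refine Fin.cases h0 (fun i => ?_) i
      have hi := h.2 i
      rcases hε i.succ with h1 | h1 <;> rcases hδ i.succ with h2 | h2 <;>
        rcases hδ 0 with h3 | h3 <;> rw [h0, h1, h2, h3] at hi <;> norm_num at hi <;> rw [h1, h2]
  refine hle.trans ?_
  rw [Set.ncard_coe_finset, card_product, card_univ, Fintype.card_prop]
  refine Nat.mul_le_mul_left 2 ((card_positivePatterns_le V).trans ?_)
  exact sum_le_sum_of_subset (range_subset_range.mpr hrank)

/-- Evaluations of polynomials of degree less than `d` lie in the span of the first `d` powers. -/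
theorem eval_mem_span_pow {n d : ℕ} (t : Fin n → ℝ) (p : Polynomial ℝ) (hp : p.natDegree < d) :
    (fun i => p.eval (t i)) ∈
      Submodule.span ℝ (Set.range fun (k : Fin d) (i : Fin n) => t i ^ (k : ℕ)) := by
  have : (fun i => p.eval (t i)) =
      ∑ k : Fin d, p.coeff k • (fun (i : Fin n) => t i ^ (k : ℕ)) := by
    funext i
    rw [Polynomial.eval_eq_sum_range' hp, ← Fin.sum_univ_eq_sum_range
      (fun k => p.coeff k * t i ^ k) d]
    simp
  rw [this]
  exact Submodule.sum_mem _ fun k _ => Submodule.smul_mem _ _ (Submodule.subset_span ⟨k, rfl⟩)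

/-- The sign vector with first entry `b` whose sign changes occur exactly at the positions
in `S`. -/
noncomputable def signVector {m : ℕ} (b : ℝ) (S : Finset (Fin m)) (i : Fin (m + 1)) : ℝ :=
  b * ∏ j ∈ S, if j.castSucc < i then -1 else 1

theorem signVector_zero {m : ℕ} (b : ℝ) (S : Finset (Fin m)) : signVector b S 0 = b := by
  simp [signVector]

theorem signVector_succ {m : ℕ} (b : ℝ) (S : Finset (Fin m)) (j : Fin m) :
    signVector b S j.succ = signVector b S j.castSucc * if j ∈ S then -1 else 1 := by
  rw [signVector, signVector, mul_assoc, ← prod_ite_eq' S j (fun _ => (-1 : ℝ)),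
    ← prod_mul_distrib]
  congr 1
  refine prod_congr rfl fun k _ => ?_
  rcases lt_trichotomy k j with h | rfl | h
  · simp [h, h.le, h.ne, Fin.castSucc_lt_succ_iff]
  · simp
  · simp [h.not_ge, h.not_gt, h.ne', Fin.castSucc_lt_succ_iff]

theorem signVector_eq {m : ℕ} {b : ℝ} (hb : b = 1 ∨ b = -1) (S : Finset (Fin m))
    (i : Fin (m + 1)) : signVector b S i = 1 ∨ signVector b S i = -1 := by
  induction i using Fin.induction with
  | zero => rwa [signVector_zero]
  | succ j ih =>
    rw [signVector_succ]
    rcases ih with h | h <;> rw [h] <;> split_ifs <;> norm_num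

theorem signVector_injOn {m : ℕ} :
    Set.InjOn (fun q : ℝ × Finset (Fin m) => signVector q.1 q.2) {q | q.1 = 1 ∨ q.1 = -1} := by
  rintro ⟨b, S⟩ hb ⟨c, T⟩ - h
  replace h (i : Fin (m + 1)) : signVector b S i = signVector c T i := congrFun h i
  refine Prod.ext (by simpa [signVector_zero] using h 0) (Finset.ext fun j => ?_)
  have hj := h j.succ
  rw [signVector_succ, signVector_succ, ← h] at hj
  have hne : signVector b S j.castSucc ≠ 0 := by
    rcases signVector_eq hb S j.castSucc with h' | h' <;> rw [h'] <;> norm_num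
  have := mul_left_cancel₀ hne hj
  by_cases h1 : j ∈ S <;> by_cases h2 : j ∈ T <;>
    simp only [h1, h2, if_true, if_false] at this ⊢ <;>
    norm_num at this

/-- The span of the first `d` powers of `0, 1, …, m` meets every orthant with fewer than `d`
sign changes. -/
theorem exists_mem_span_pow_signVector {m d : ℕ} {b : ℝ} (hb : b = 1 ∨ b = -1)
    (S : Finset (Fin m)) (hS : #S < d) :
    ∃ x ∈ Submodule.span ℝ
      (Set.range fun (k : Fin d) (i : Fin (m + 1)) => ((i : ℕ) : ℝ) ^ (k : ℕ)),
      ∀ i, 0 < signVector b S i * x i := by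
  let p : Polynomial ℝ := .C b * ∏ j ∈ S, (.C ((j : ℕ) + 1 / 2 : ℝ) - .X)
  have hp : p.natDegree < d := by
    refine lt_of_le_of_lt ?_ hS
    refine (Polynomial.natDegree_C_mul_le _ _).trans ?_
    refine (Polynomial.natDegree_prod_le _ _).trans ?_
    rw [card_eq_sum_ones]
    exact sum_le_sum fun j _ => (Polynomial.natDegree_sub_le _ _).trans (by simp)
  refine ⟨_, eval_mem_span_pow (fun i : Fin (m + 1) => ((i : ℕ) : ℝ)) p hp, fun i => ?_⟩
  have hbb : b * b = 1 := by rcases hb with rfl | rfl <;> norm_num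
  have : signVector b S i * p.eval ((i : ℕ) : ℝ) =
      ∏ j ∈ S, (if j.castSucc < i then -1 else 1) * (((j : ℕ) : ℝ) + 1 / 2 - (i : ℕ)) := by
    simp only [p, signVector, Polynomial.eval_mul, Polynomial.eval_prod, Polynomial.eval_sub,
      Polynomial.eval_C, Polynomial.eval_X, prod_mul_distrib]
    linear_combination (∏ j ∈ S, if j.castSucc < i then (-1 : ℝ) else 1) *
      (∏ j ∈ S, (((j : ℕ) : ℝ) + 1 / 2 - (i : ℕ))) * hbb
  rw [this]
  refine prod_pos fun j _ => ?_
  split_ifs with h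
  · have : ((j : ℕ) : ℝ) + 1 ≤ (i : ℕ) := by exact_mod_cast h
    linarith
  · have : ((i : ℕ) : ℝ) ≤ (j : ℕ) := by exact_mod_cast not_lt.mp h
    linarith

theorem le_orthantCount_pow (m d : ℕ) :
    2 * ∑ i ∈ range d, m.choose i ≤
      orthantCount (m + 1) d (fun k i => ((i : ℕ) : ℝ) ^ (k : ℕ)) := by
  classical
  let 𝒮 : Finset (Finset (Fin m)) := (range d).biUnion fun i => powersetCard i univ
  have hcard : #𝒮 = ∑ i ∈ range d, m.choose i := by
    rw [card_biUnion fun i _ j _ hij => pairwise_disjoint_powersetCard _ hij]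
    simp
  have hpair : #({1, -1} : Finset ℝ) = 2 := card_pair (by norm_num)
  rw [← hcard, ← hpair, ← card_product, ← Set.ncard_coe_finset]
  refine Set.ncard_le_ncard_of_injOn (fun q => signVector q.1 q.2) ?_
    (signVector_injOn.mono ?_) (finite_signs _ _)
  · rintro ⟨b, S⟩ hq
    obtain ⟨hb, hS⟩ : (b = 1 ∨ b = -1) ∧ #S < d := by simpa [𝒮] using hq
    exact ⟨signVector_eq hb S, exists_mem_span_pow_signVector hb S hS⟩
  · rintro ⟨b, S⟩ hq
    have : (b = 1 ∨ b = -1) ∧ #S < d := by simpa [𝒮] using hq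
    exact this.1

theorem maxOrthantCount_succ (m d : ℕ) :
    maxOrthantCount (m + 1) d = 2 * ∑ i ∈ range d, m.choose i := by
  rw [maxOrthantCount]
  split_ifs with hd
  · simp [hd]
  have hub : 2 * ∑ i ∈ range d, m.choose i ∈
      upperBounds {c : ℕ | ∃ v : Fin d → (Fin (m + 1) → ℝ), c = orthantCount (m + 1) d v} := by
    rintro _ ⟨v, rfl⟩
    exact orthantCount_le m d v
  exact le_antisymm (csSup_le ⟨_, 0, rfl⟩ hub)
    ((le_orthantCount_pow m d).trans (le_csSup ⟨_, hub⟩ ⟨_, rfl⟩))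

theorem sum_range_choose_add_sum_range_choose {m d e : ℕ} (h : d + e = m + 1) :
    ∑ i ∈ range d, m.choose i + ∑ i ∈ range e, m.choose i = 2 ^ m := by
  rw [← Nat.sum_range_choose, ← h, sum_range_add, ← sum_range_reflect _ e]
  congr 1
  refine sum_congr rfl fun i hi => ?_
  have := mem_range.mp hi
  exact Nat.choose_symm_of_eq_add (by omega)

/-- The complementarity relation `C(n,d) = 2^n - C(n, n-d)` for `0 ≤ d ≤ n`. -/
theorem maxOrthantCount_complement (n d : ℕ) (hn : 0 < n) (hd : d ≤ n) :
    maxOrthantCount n d = 2 ^ n - maxOrthantCount n (n - d) := by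
  obtain ⟨m, rfl⟩ := Nat.exists_eq_add_one.mpr hn
  have := sum_range_choose_add_sum_range_choose (Nat.add_sub_cancel' hd)
  rw [maxOrthantCount_succ, maxOrthantCount_succ, pow_succ]
  omega
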